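/- arXiv:1210.1475 — 12 statements merged into one kernel-verified Lean document; each statement's English description precedes it below -/
import Mathlib

section
/- Let M be a finite automatic algebra with state set Q and letter set Σ. Then the following are equivalent: (1) every letter a ∈ Σ acts as whiskery cycles, i.e., for every q ∈ Q there exists n ≥ 1 with q·a = q·a^{n+1}; (2) M satisfies the quasi-equation v·x·x = w·x·x → v·x = w·x, i.e., for all v, w, x ∈ M, if (v·x)·x = (w·x)·x then v·x = w·x. -/
/-- The multiplication of an automatic algebra with state set `Q`, letter set `S`,
zero element `none`, and partial transition function `δ`:
`q · a = δ q a` when defined, and all other products are `0` (= `none`). -/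
def autMul {Q S : Type} (δ : Q → S → Option Q) :
    Option (Q ⊕ S) → Option (Q ⊕ S) → Option (Q ⊕ S)
  | some (Sum.inl q), some (Sum.inr a) => (δ q a).map Sum.inl
  | _, _ => none

/-- The left-bracketed repeated product `u · a^k = (⋯((u·a)·a)⋯)·a` with `k` factors `a`. -/
def autPow {Q S : Type} (δ : Q → S → Option Q) (u : Option (Q ⊕ S)) (a : S) :
    ℕ → Option (Q ⊕ S)
  | 0 => u
  | n + 1 => autMul δ (autPow δ u a n) (some (Sum.inr a))

open Function in
/-- A self-map `f` of a finite type is injective on its range iff every point of the range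
is periodic. -/
theorem forall_exists_iterate_succ_iff {α : Type*} [Finite α] (f : α → α) :
    (∀ u, ∃ n : ℕ, 1 ≤ n ∧ f u = f^[n + 1] u) ↔ ∀ v w, f (f v) = f (f w) → f v = f w := by
  constructor
  · intro h v w hvw
    obtain ⟨n, hn, hv⟩ := h v
    obtain ⟨m, hm, hw⟩ := h w
    have pv : IsPeriodicPt f (n * m) (f v) := IsPeriodicPt.mul_const (m := n) hv.symm m
    have pw : IsPeriodicPt f (n * m) (f w) := IsPeriodicPt.const_mul (m := m) hw.symm n
    obtain ⟨k, hk⟩ : ∃ k, n * m = k + 1 :=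
      Nat.exists_eq_succ_of_ne_zero (Nat.mul_pos hn hm).ne'
    rw [← pv.eq, ← pw.eq, hk, iterate_succ_apply, iterate_succ_apply, hvw]
  · intro h u
    have maps : Set.MapsTo f (Set.range f) (Set.range f) := fun x _ => ⟨x, rfl⟩
    have inj : Injective (maps.restrict f _ _) := by
      rintro ⟨_, v, rfl⟩ ⟨_, w, rfl⟩ hvw
      exact Subtype.ext (h v w (congrArg Subtype.val hvw))
    obtain ⟨n, hn, hp⟩ := inj.mem_periodicPts ⟨f u, u, rfl⟩
    refine ⟨n, hn, ?_⟩
    have := congrArg Subtype.val hp.eq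
    rw [Set.MapsTo.iterate_restrict] at this
    exact this.symm

theorem autPow_eq_iterate {Q S : Type} (δ : Q → S → Option Q) (u : Option (Q ⊕ S)) (a : S)
    (n : ℕ) : autPow δ u a n = (fun t => autMul δ t (some (Sum.inr a)))^[n] u := by
  induction n with
  | zero => rfl
  | succ n ih => rw [Function.iterate_succ_apply', ← ih]; rfl

/-- For a finite automatic algebra `M`, the following are equivalent:
(1) every letter acts as whiskery cycles, i.e. for every letter `a` and state `q`
there is `n ≥ 1` with `q·a = q·a^(n+1)`;
(2) `M` satisfies the quasi-equation `v·x·x = w·x·x → v·x = w·x`. -/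
theorem whiskery_iff_quasi {Q S : Type} [Fintype Q] [Fintype S]
    (δ : Q → S → Option Q) :
    (∀ (a : S) (q : Q), ∃ n : ℕ, 1 ≤ n ∧
        autMul δ (some (Sum.inl q)) (some (Sum.inr a)) =
          autPow δ (some (Sum.inl q)) a (n + 1)) ↔
    (∀ v w x : Option (Q ⊕ S),
        autMul δ (autMul δ v x) x = autMul δ (autMul δ w x) x →
          autMul δ v x = autMul δ w x) := by
  constructor
  · intro h v w x
    rcases x with _ | q | a
    · intro _; rcases v with _ | _ | _ <;> rcases w with _ | _ | _ <;> rfl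
    · intro _; rcases v with _ | _ | _ <;> rcases w with _ | _ | _ <;> rfl
    · refine (forall_exists_iterate_succ_iff fun t => autMul δ t (some (Sum.inr a))).1 ?_ v w
      rintro (_ | q | b)
      · exact ⟨1, le_rfl, rfl⟩
      · simpa only [autPow_eq_iterate] using h a q
      · exact ⟨1, le_rfl, rfl⟩
  · intro h a q
    simpa only [autPow_eq_iterate] using
      (forall_exists_iterate_succ_iff fun t => autMul δ t (some (Sum.inr a))).2
        (fun v w => h v w _) (some (Sum.inl q))
end

section
/- Let M be a finite automatic algebra with state set Q and letter set Σ. Then every letter of M acts as whiskery cycles (for every a ∈ Σ and q ∈ Q there exists n ≥ 1 with q·a = q·a^{n+1}) if and only if for no m ∈ ℕ ∪ {0} does the automatic algebra F_m admit an injective multiplication-preserving map into M. -/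
/-- The transition function of the automatic algebra `F_m`, with states
`0 = q`, `1 = r`, `2 = s₁, …, m+1 = s_m` and a single letter.
For `m = 0`: the only transition is `q·a = r`.
For `m ≥ 1`: `q·a = r`, `r·a = s₁`, `sᵢ·a = s_{i+1}` for `i < m`, and `s_m·a = s₁`. -/
def Fδ (m : ℕ) (i : Fin (m + 2)) (_ : Unit) : Option (Fin (m + 2)) :=
  if _h0 : m = 0 then
    if (i : ℕ) = 0 then some ⟨1, by omega⟩ else none
  else
    if _h : (i : ℕ) ≤ m then some ⟨(i : ℕ) + 1, by omega⟩ else some ⟨2, by omega⟩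

/-- The action of the letter `a` on states, extended to the zero element `none`. -/
def letterAct {Q S : Type} (δ : Q → S → Option Q) (a : S) (o : Option Q) : Option Q :=
  o.bind fun q => δ q a

theorem autPow_state {Q S : Type} (δ : Q → S → Option Q) (a : S) (q : Q) (n : ℕ) :
    autPow δ (some (Sum.inl q)) a n = ((letterAct δ a)^[n] (some q)).map Sum.inl := by
  induction n with
  | zero => rfl
  | succ n ih =>
    rw [autPow, ih, Function.iterate_succ_apply']
    cases (letterAct δ a)^[n] (some q) <;> rfl

theorem autMul_self {Q S : Type} (δ : Q → S → Option Q) (x : Option (Q ⊕ S)) :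
    autMul δ x x = none := by
  rcases x with _ | _ | _ <;> rfl

theorem exists_of_autMul_ne_none {Q S : Type} {δ : Q → S → Option Q} {x y : Option (Q ⊕ S)}
    (h : autMul δ x y ≠ none) : ∃ q a, x = some (Sum.inl q) ∧ y = some (Sum.inr a) := by
  rcases x with _ | q | b <;> rcases y with _ | p | a <;> first | exact absurd rfl h | skip
  exact ⟨q, a, rfl, rfl⟩

theorem Fδ_zero (m : ℕ) : Fδ m 0 () = some 1 := by
  by_cases hm : m = 0
  · subst hm; rfl
  · simp [Fδ, hm]

theorem Fδ_ne_zero (m : ℕ) (i : Fin (m + 2)) : Fδ m i () ≠ some 0 := by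
  unfold Fδ
  intro h
  split_ifs at h <;> exact absurd (congrArg Fin.val (Option.some.inj h)) (Nat.succ_ne_zero _)

theorem eq_zero_of_Fδ_eq_one {m : ℕ} {i : Fin (m + 2)} (h : Fδ m i () = some 1) : i = 0 := by
  unfold Fδ at h
  split_ifs at h with h0 hi hi
  · exact Fin.ext hi
  all_goals have hv := congrArg Fin.val (Option.some.inj h)
  · exact Fin.ext (Nat.succ_injective hv)
  · exact absurd hv (Nat.succ_succ_ne_one 0)

theorem iterate_letterAct_Fδ_ne (m n : ℕ) :
    (letterAct (Fδ m) ())^[n + 2] (some 0) ≠ some 1 := by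
  have step (k : ℕ) (j : Fin (m + 2)) (h : (letterAct (Fδ m) ())^[k + 1] (some 0) = some j) :
      ∃ i, (letterAct (Fδ m) ())^[k] (some 0) = some i ∧ Fδ m i () = some j := by
    rw [Function.iterate_succ_apply'] at h
    exact Option.bind_eq_some_iff.mp h
  intro h
  obtain ⟨i, hi, h1⟩ := step (n + 1) 1 h
  obtain rfl := eq_zero_of_Fδ_eq_one h1
  obtain ⟨i, -, h0⟩ := step n 0 hi
  exact Fδ_ne_zero m i h0

theorem map_autPow {Q S Q' S' : Type} {δ : Q → S → Option Q} {δ' : Q' → S' → Option Q'}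
    {f : Option (Q ⊕ S) → Option (Q' ⊕ S')} (hf : ∀ x y, f (autMul δ x y) = autMul δ' (f x) (f y))
    {a : S} {a' : S'} (ha : f (some (Sum.inr a)) = some (Sum.inr a')) (u : Option (Q ⊕ S)) (n : ℕ) :
    f (autPow δ u a n) = autPow δ' (f u) a' n := by
  induction n with
  | zero => rfl
  | succ n ih => rw [autPow, autPow, hf, ih, ha]

/-- An injective map of states intertwining the actions of one letter of each algebra extends to
an embedding of a one-letter automatic algebra. -/
theorem exists_embedding_of_states {Q S P : Type} (δ : Q → S → Option Q) (ε : P → Unit → Option P)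
    (a : S) (p : P → Q) (hp : Function.Injective p) (h : ∀ i, δ (p i) a = (ε i ()).map p) :
    ∃ f : Option (P ⊕ Unit) → Option (Q ⊕ S), Function.Injective f ∧
      ∀ x y, f (autMul ε x y) = autMul δ (f x) (f y) := by
  refine ⟨Option.map (Sum.map p fun _ => a),
    Option.map_injective (hp.sumMap (Function.injective_of_subsingleton _)), ?_⟩
  rintro (_ | i | _) (_ | j | _) <;> try rfl
  simp [autMul, h, Function.comp_def]

/-- An orbit of a letter that does not return to its second point yields an embedded `F_m`. -/
theorem exists_Fδ_states {Q S : Type} [Finite Q] (δ : Q → S → Option Q) (a : S) (q : Q)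
    (h : ∀ n, 1 ≤ n → letterAct δ a (some q) ≠ (letterAct δ a)^[n + 1] (some q)) :
    ∃ (m : ℕ) (p : Fin (m + 2) → Q), Function.Injective p ∧
      ∀ i, δ (p i) a = (Fδ m i ()).map p := by
  classical
  set g := letterAct δ a
  set y : ℕ → Option Q := fun n => g^[n] (some q) with hy
  have ysucc (n : ℕ) : y (n + 1) = g (y n) := Function.iterate_succ_apply' ..
  have yadd (n k : ℕ) : y (n + k) = g^[k] (y n) := by
    simp only [hy]; rw [Nat.add_comm, Function.iterate_add_apply]
  have per_of_eq {i j : ℕ} (hij : i < j) (e : y i = y j) : y i ∈ Function.periodicPts g := by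
    refine Function.mk_mem_periodicPts (Nat.sub_pos_of_lt hij) ?_
    rw [Function.IsPeriodicPt, Function.IsFixedPt, ← yadd, Nat.add_sub_cancel' hij.le, e]
  have hex : ∃ k, y k ∈ Function.periodicPts g := by
    obtain ⟨i, j, hij, e⟩ := Finite.exists_ne_map_eq_of_infinite y
    rcases lt_or_gt_of_ne hij with hlt | hlt
    · exact ⟨i, per_of_eq hlt e⟩
    · exact ⟨j, per_of_eq hlt e.symm⟩
  have h1 : y 1 ∉ Function.periodicPts g := by
    rintro ⟨n, hn, e⟩
    apply h n hn
    have : y (1 + n) = y 1 := by rw [yadd]; exact e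
    rw [Nat.add_comm] at this
    exact this.symm
  have h0 : y 0 ∉ Function.periodicPts g := fun ⟨n, hn, e⟩ =>
    h1 ⟨n, hn, by rw [ysucc]; exact e.map (Function.Commute.refl g).semiconj⟩
  obtain ⟨K, hK, hmin⟩ : ∃ K, y (K + 2) ∈ Function.periodicPts g ∧
      ∀ k < K + 2, y k ∉ Function.periodicPts g := by
    obtain ⟨k, hk, hk'⟩ : ∃ k, y k ∈ Function.periodicPts g ∧
        ∀ j < k, y j ∉ Function.periodicPts g :=
      ⟨Nat.find hex, Nat.find_spec hex, fun j hj => Nat.find_min hex hj⟩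
    match k, hk, hk' with
    | 0, hk, _ => exact absurd hk h0
    | 1, hk, _ => exact absurd hk h1
    | K + 2, hk, hk' => exact ⟨K, hk, hk'⟩
  have gnone : g none = none := rfl
  have none_per : none ∈ Function.periodicPts g := ⟨1, one_pos, gnone⟩
  have some_of_lt {k : ℕ} (hk : k < K + 2) : y k ≠ none := fun e => hmin k hk (e ▸ none_per)
  have choice_states (m : ℕ) (hm : ∀ i < m + 2, y (K + i) ≠ none) :
      ∃ p : Fin (m + 2) → Q, ∀ i : Fin (m + 2), y (K + i) = some (p i) := by
    choose p hp using fun i : Fin (m + 2) => Option.ne_none_iff_exists'.mp (hm i i.2)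
    exact ⟨p, hp⟩
  have act {r : Q} {k : ℕ} (e : y k = some r) : δ r a = y (k + 1) := by
    rw [ysucc, e]; rfl
  by_cases hn : y (K + 2) = none
  · obtain ⟨p, hp⟩ := choice_states 0 fun i hi => some_of_lt (by omega)
    refine ⟨0, p, fun i j hij => ?_, fun i => ?_⟩
    · have e : y (K + i) = y (K + j) := by rw [hp, hp, hij]
      rcases lt_trichotomy (i : ℕ) j with hlt | heq | hlt
      · exact absurd (per_of_eq (by omega) e) (hmin _ (by omega))
      · exact Fin.ext heq
      · exact absurd (per_of_eq (by omega) e.symm) (hmin _ (by omega))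
    · rw [act (hp i)]
      fin_cases i
      · exact hp 1
      · exact hn
  · set m := Function.minimalPeriod g (y (K + 2))
    have mpos : 0 < m := Function.minimalPeriod_pos_of_mem_periodicPts hK
    have ret : y (K + 2 + m) = y (K + 2) := by
      rw [yadd]; exact Function.isPeriodicPt_minimalPeriod ..
    have stays {k l : ℕ} (hk : y k = none) (hkl : k ≤ l) : y l = none := by
      obtain ⟨d, rfl⟩ := Nat.exists_eq_add_of_le hkl
      rw [yadd, hk]; exact Function.iterate_fixed gnone d
    obtain ⟨p, hp⟩ := choice_states m fun i hi e => hn (ret ▸ stays e (by omega))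
    have inj_lt {i j : Fin (m + 2)} (hlt : (i : ℕ) < j) : p i ≠ p j := by
      intro hij
      have e : y (K + i) = y (K + j) := by rw [hp, hp, hij]
      have hi : 2 ≤ (i : ℕ) := by
        by_contra hi
        exact hmin _ (by omega) (per_of_eq (by omega) e)
      obtain ⟨i', hi'⟩ := Nat.exists_eq_add_of_le hi
      obtain ⟨j', hj'⟩ := Nat.exists_eq_add_of_le (hi.trans hlt.le)
      rw [hi', hj', ← Nat.add_assoc, ← Nat.add_assoc, yadd _ i', yadd _ j'] at e
      have := Function.iterate_injOn_Iio_minimalPeriod (f := g) (x := y (K + 2))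
        (show i' < m by omega) (show j' < m by omega) e
      omega
    refine ⟨m, p, fun i j hij => ?_, fun i => ?_⟩
    · rcases lt_trichotomy (i : ℕ) j with hlt | heq | hlt
      · exact absurd hij (inj_lt hlt)
      · exact Fin.ext heq
      · exact absurd hij.symm (inj_lt hlt)
    · rw [act (hp i), Fδ, dif_neg mpos.ne']
      split_ifs with hi
      · exact hp ⟨i + 1, by omega⟩
      · have hi' : (i : ℕ) = m + 1 := by omega
        rw [hi', show K + (m + 1) + 1 = K + 2 + m by omega, ret]
        exact hp ⟨2, by omega⟩

/-- Every letter of a finite automatic algebra `M` acts as whiskery cycles if and only if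
for no `m ∈ ℕ ∪ {0}` does the automatic algebra `F_m` admit an injective
multiplication-preserving map into `M`. -/
theorem whiskery_iff_no_Fm_embeds {Q S : Type} [Fintype Q] [Fintype S]
    (δ : Q → S → Option Q) :
    (∀ (a : S) (q : Q), ∃ n : ℕ, 1 ≤ n ∧
        autMul δ (some (Sum.inl q)) (some (Sum.inr a)) =
          autPow δ (some (Sum.inl q)) a (n + 1)) ↔
    (∀ m : ℕ, ¬ ∃ f : Option (Fin (m + 2) ⊕ Unit) → Option (Q ⊕ S),
        Function.Injective f ∧
        ∀ x y, f (autMul (Fδ m) x y) = autMul δ (f x) (f y)) := by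
  constructor
  · rintro h m ⟨f, hinj, hf⟩
    have f_none : f none = none := by
      have := hf none none
      rwa [autMul_self, autMul_self] at this
    have hmul : autMul (Fδ m) (some (Sum.inl 0)) (some (Sum.inr ())) = some (Sum.inl 1) := by
      simp [autMul, Fδ_zero]
    have hne : autMul δ (f (some (Sum.inl 0))) (f (some (Sum.inr ()))) ≠ none := by
      rw [← hf, hmul, ← f_none]
      exact fun e => nomatch hinj e
    obtain ⟨q, a, hq, ha⟩ := exists_of_autMul_ne_none hne
    obtain ⟨n, hn, e⟩ := h a q
    rw [← hq, ← map_autPow hf ha, ← ha, ← hf, hmul, autPow_state] at e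
    obtain ⟨k, rfl⟩ := Nat.exists_eq_add_of_le' hn
    obtain ⟨r, hr, hr'⟩ := Option.map_eq_some_iff.mp (hinj e).symm
    exact iterate_letterAct_Fδ_ne m k (hr.trans (congrArg some (Sum.inl_injective hr')))
  · intro h a q
    by_contra! hne
    obtain ⟨m, p, hp, hδ⟩ := exists_Fδ_states δ a q fun n hn e => hne n hn (by
      rw [autPow_state, ← e]; rfl)
    exact h m (exists_embedding_of_states δ (Fδ m) a p hp hδ)
end

section
/- Let M be a finite magma, let A be a magma that embeds into some power of M, let k ≥ 1, and let f : Hom(A,M) → M. Then f is k-locally an evaluation if and only if f preserves every k-ary compatible relation on M. -/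
/-- A nonempty type's finset with at most `k` elements is covered by a `k`-tuple. -/
theorem Finset.exists_fin_tuple_covering {α : Type*} [Nonempty α] {k : ℕ} (X : Finset α)
    (hX : X.card ≤ k) : ∃ x : Fin k → α, ∀ y ∈ X, ∃ i, x i = y := by
  classical
  refine ⟨fun i => if h : i.1 < X.card then X.equivFin.symm ⟨i.1, h⟩ else Classical.arbitrary α,
    fun y hy => ⟨Fin.castLE hX (X.equivFin ⟨y, hy⟩), ?_⟩⟩
  simp

/-- The Preservation Lemma.  Let `M` be a finite magma, let `A` be a magma
embedding into some power of `M`, let `k ≥ 1`, and let `f : Hom(A,M) → M`.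
Then `f` is `k`-locally an evaluation iff `f` preserves every `k`-ary
compatible relation on `M`. -/
theorem locally_evaluation_iff_preserves_compatible_relations
    {M A : Type} [Mul M] [Mul A] [Fintype M]
    (hA : ∃ (I : Type) (g : A → I → M), Function.Injective g ∧
        ∀ x y : A, g (x * y) = fun i => g x i * g y i)
    (k : ℕ) (hk : 1 ≤ k)
    (f : {x : A → M // ∀ p q : A, x (p * q) = x p * x q} → M) :
    (∀ X : Finset {x : A → M // ∀ p q : A, x (p * q) = x p * x q},
        X.card ≤ k → ∃ a : A, ∀ x ∈ X, f x = x.1 a) ↔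
    (∀ r : Set (Fin k → M),
        (∀ p ∈ r, ∀ q ∈ r, (fun i => p i * q i) ∈ r) →
        ∀ x : Fin k → {x : A → M // ∀ p q : A, x (p * q) = x p * x q},
          (∀ a : A, (fun i => (x i).1 a) ∈ r) → (fun i => f (x i)) ∈ r) := by
  classical
  constructor
  · intro h r _ x hx
    obtain ⟨a, ha⟩ := h (Finset.univ.image x) (Finset.card_image_le.trans (by simp))
    have hfx : (fun i => f (x i)) = fun i => (x i).1 a :=
      funext fun i => ha _ (Finset.mem_image_of_mem x (Finset.mem_univ i))
    exact hfx ▸ hx a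
  · intro h X hX
    by_cases hHom : Nonempty {x : A → M // ∀ p q : A, x (p * q) = x p * x q}
    · obtain ⟨x, hx⟩ := X.exists_fin_tuple_covering hX
      obtain ⟨a, ha⟩ := h (Set.range fun a i => (x i).1 a)
        (by
          rintro _ ⟨a, rfl⟩ _ ⟨b, rfl⟩
          exact ⟨a * b, funext fun i => (x i).2 a b⟩)
        x (fun a => ⟨a, rfl⟩)
      refine ⟨a, fun y hy => ?_⟩
      obtain ⟨i, rfl⟩ := hx y hy
      exact (congrFun ha i).symm
    · rcases isEmpty_or_nonempty A with hE | ⟨⟨a⟩⟩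
      · exact (hHom ⟨⟨fun a => hE.elim a, fun a => hE.elim a⟩⟩).elim
      · exact ⟨a, fun y _ => (hHom ⟨y⟩).elim⟩
end

section
/- Let M be a finite magma, let A be a finite magma that embeds into some power of M, and let f : Hom(A,M) → M. Assume there exists u in the range of f such that for every v ∈ M there is a multiplication-preserving map g_{u,v} : M × M → M satisfying: for all x, y ∈ M, g_{u,v}(x,y) = u if and only if (x,y) = (u,v). If f is 3-locally an evaluation, then f is an evaluation. -/
/-- Lemma (GST-style).  Let `M` be a finite magma and `A` a finite magma embedding into a
power of `M`, and let `f : Hom(A,M) → M`.  Assume there is `u` in the range of `f` such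
that for every `v ∈ M` there is a multiplication-preserving map `g : M × M → M` with
`g (x,y) = u ↔ (x,y) = (u,v)`.  If `f` is `3`-locally an evaluation, then `f` is an
evaluation. -/
theorem three_locally_evaluation_implies_evaluation
    {M A : Type} [Mul M] [Mul A] [Fintype M] [Fintype A]
    (hA : ∃ (I : Type) (g : A → I → M), Function.Injective g ∧
        ∀ x y : A, g (x * y) = fun i => g x i * g y i)
    (f : {x : A → M // ∀ p q : A, x (p * q) = x p * x q} → M)
    (u : M) (huran : u ∈ Set.range f)
    (hg : ∀ v : M, ∃ g : M × M → M,
        (∀ p q : M × M, g (p * q) = g p * g q) ∧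
        (∀ x y : M, g (x, y) = u ↔ (x, y) = (u, v)))
    (hloc : ∀ X : Finset {x : A → M // ∀ p q : A, x (p * q) = x p * x q},
        X.card ≤ 3 → ∃ a : A, ∀ x ∈ X, f x = x.1 a) :
    ∃ a : A, ∀ x : {x : A → M // ∀ p q : A, x (p * q) = x p * x q}, f x = x.1 a := by
  classical
  have key : ∀ S : Finset {x : A → M // ∀ p q : A, x (p * q) = x p * x q},
      ∃ z : {x : A → M // ∀ p q : A, x (p * q) = x p * x q},
        f z = u ∧ ∀ a : A, z.1 a = u → ∀ y ∈ S, f y = y.1 a := by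
    intro S
    induction S using Finset.induction_on with
    | empty =>
      obtain ⟨x, hx⟩ := huran
      exact ⟨x, hx, by simp⟩
    | insert y S _ ih =>
      obtain ⟨x, hx, hxS⟩ := ih
      obtain ⟨g, hmul, hgu⟩ := hg (f y)
      let z : {x : A → M // ∀ p q : A, x (p * q) = x p * x q} :=
        ⟨fun a => g (x.1 a, y.1 a), fun p q => by
          beta_reduce
          rw [x.2, y.2]
          exact hmul (x.1 p, y.1 p) (x.1 q, y.1 q)⟩
      obtain ⟨a, ha⟩ := hloc {x, y, z} Finset.card_le_three
      refine ⟨z, ?_, fun b hb => ?_⟩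
      · rw [ha z (by simp)]
        refine (hgu _ _).2 ?_
        rw [← ha x (by simp), ← ha y (by simp), hx]
      · obtain ⟨hxb, hyb⟩ := Prod.mk.inj ((hgu _ _).1 hb)
        intro w hw
        rcases Finset.mem_insert.1 hw with rfl | hw
        · exact hyb.symm
        · exact hxS b hxb w hw
  obtain ⟨z, hz, hzS⟩ := key Finset.univ
  obtain ⟨a, ha⟩ := hloc {z} (by simp)
  exact ⟨a, fun x => hzS a ((ha z (by simp)).symm.trans hz) x (Finset.mem_univ x)⟩
end

section
/- Let M be a finite automatic algebra with letter set Σ, let A be a finite magma that embeds into some power of M, and let f : Hom(A,M) → M be such that the range of f meets Σ. If f is 3-locally an evaluation, then f is an evaluation. -/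
theorem autMul_ne_letter {Q S : Type} (δ : Q → S → Option Q) (u v : Option (Q ⊕ S)) (s : S) :
    autMul δ u v ≠ some (Sum.inr s) := by
  unfold autMul
  split <;> simp

/-- A map whose only nonzero value is a single letter, never taken on a product, is
multiplication-preserving. -/
theorem ite_letter_mul {Q S A : Type} [Mul A] (δ : Q → S → Option Q) (s : S) (P : A → Prop)
    [DecidablePred P] (hP : ∀ p q : A, ¬ P (p * q)) (p q : A) :
    (if P (p * q) then some (Sum.inr s) else none : Option (Q ⊕ S)) =
      autMul δ (if P p then some (Sum.inr s) else none)
        (if P q then some (Sum.inr s) else none) := by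
  rw [if_neg (hP p q)]
  split_ifs <;> rfl

/-- Let `M` be a finite automatic algebra with letter set `S`, let `A` be a finite magma
embedding into some power of `M`, and let `f : Hom(A,M) → M` be such that the range of `f`
meets `S`.  If `f` is `3`-locally an evaluation, then `f` is an evaluation. -/
theorem letter_in_range_three_locally_evaluation
    {Q S A : Type} [Fintype Q] [Fintype S] [Fintype A] [Mul A]
    (δ : Q → S → Option Q)
    (hA : ∃ (I : Type) (g : A → I → Option (Q ⊕ S)), Function.Injective g ∧
        ∀ x y : A, g (x * y) = fun i => autMul δ (g x i) (g y i))
    (f : {x : A → Option (Q ⊕ S) // ∀ p q : A, x (p * q) = autMul δ (x p) (x q)} →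
        Option (Q ⊕ S))
    (hran : ∃ a : S, some (Sum.inr a) ∈ Set.range f)
    (hloc : ∀ X : Finset
        {x : A → Option (Q ⊕ S) // ∀ p q : A, x (p * q) = autMul δ (x p) (x q)},
        X.card ≤ 3 → ∃ a : A, ∀ x ∈ X, f x = x.1 a) :
    ∃ a : A, ∀ x : {x : A → Option (Q ⊕ S) // ∀ p q : A, x (p * q) = autMul δ (x p) (x q)},
      f x = x.1 a := by
  classical
  let B (x : {x : A → Option (Q ⊕ S) // ∀ p q : A, x (p * q) = autMul δ (x p) (x q)}) :
      Finset A := {a | f x = x.1 a}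
  obtain ⟨s₀, x₀, hx₀⟩ := hran
  obtain ⟨x, ⟨s, hs⟩, hmin⟩ := exists_minimalFor_of_wellFoundedLT
    (fun x => ∃ s : S, f x = some (Sum.inr s)) (fun x => (B x).card) ⟨x₀, s₀, hx₀⟩
  obtain ⟨c, hc⟩ := hloc {x} (by simp)
  have hcx : f x = x.1 c := hc x (by simp)
  refine ⟨c, fun y => ?_⟩
  by_contra hcy
  have hP (p q : A) : ¬ (f x = x.1 (p * q) ∧ f y = y.1 (p * q)) := by
    rintro ⟨h, -⟩
    rw [hs, x.2] at h
    exact autMul_ne_letter δ _ _ s h.symm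
  let z : {x : A → Option (Q ⊕ S) // ∀ p q : A, x (p * q) = autMul δ (x p) (x q)} :=
    ⟨fun a => if f x = x.1 a ∧ f y = y.1 a then some (Sum.inr s) else none,
      ite_letter_mul δ s (fun a => f x = x.1 a ∧ f y = y.1 a) hP⟩
  have hz : f z = some (Sum.inr s) := by
    obtain ⟨a, ha⟩ := hloc {x, y, z} Finset.card_le_three
    rw [ha z (by simp)]
    exact if_pos ⟨ha x (by simp), ha y (by simp)⟩
  have hBz {a : A} (ha : a ∈ B z) : f x = x.1 a ∧ f y = y.1 a := by
    by_contra hn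
    have h : f z = z.1 a := (Finset.mem_filter.mp ha).2
    rw [hz, show z.1 a = none from if_neg hn] at h
    cases h
  have hlt : (B z).card < (B x).card := by
    refine Finset.card_lt_card (Finset.ssubset_iff_of_subset ?_ |>.mpr ⟨c, ?_, ?_⟩)
    · exact fun a ha => Finset.mem_filter.mpr ⟨Finset.mem_univ a, (hBz ha).1⟩
    · exact Finset.mem_filter.mpr ⟨Finset.mem_univ c, hcx⟩
    · exact fun h => hcy (hBz h).2
  exact absurd (hmin ⟨s, hz⟩ hlt.le) hlt.not_ge
end

section
/- Let M be a finite automatic algebra and suppose there are distinct states q, r ∈ Q such that q is not in the range of any letter (q·? : for all a ∈ Σ and s ∈ Q, s·a ≠ q) and q·a = r·a for all a ∈ Σ. Let N be the submagma of M on M ∖ {q}. Then there is an injective multiplication-preserving map from M into N × N; explicitly, the map φ with φ(x) = (x, 0) for x ∈ N and φ(q) = (r, r) is such an embedding. Consequently every magma embeds into a power of M if and only if it embeds into a power of N. -/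
/-- A magma `(B, mB)` embeds into some power of a magma `(C, mC)`. -/
def EmbedsInPower {B C : Type} (mB : B → B → B) (mC : C → C → C) : Prop :=
  ∃ (I : Type) (g : B → I → C), Function.Injective g ∧
    ∀ x y : B, g (mB x y) = fun i => mC (g x i) (g y i)

open scoped Classical in
/-- The explicit map `φ : M → N × N` where `N = M ∖ {q}` for a redundant state `q`:
`φ x = (x, 0)` for `x ∈ N`, and `φ q = (r, r)`. -/
noncomputable def phiState {Q S : Type} (q r : Q) (hqr : q ≠ r) (x : Option (Q ⊕ S)) :
    {v : Option (Q ⊕ S) // v ≠ some (Sum.inl q)} ×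
      {v : Option (Q ⊕ S) // v ≠ some (Sum.inl q)} :=
  if h : x = some (Sum.inl q) then
    (⟨some (Sum.inl r), by simpa using hqr.symm⟩, ⟨some (Sum.inl r), by simpa using hqr.symm⟩)
  else (⟨x, h⟩, ⟨none, by simp⟩)

theorem autMul_none_right {Q S : Type} (δ : Q → S → Option Q) (x : Option (Q ⊕ S)) :
    autMul δ x none = none := by
  rcases x with _ | (_ | _) <;> rfl

theorem autMul_inl_right {Q S : Type} (δ : Q → S → Option Q) (x : Option (Q ⊕ S)) (s : Q) :
    autMul δ x (some (Sum.inl s)) = none := by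
  rcases x with _ | (_ | _) <;> rfl

/-- A state in the range of no letter is not a product. -/
theorem autMul_ne_state {Q S : Type} {δ : Q → S → Option Q} {q : Q}
    (hnotran : ∀ (s : Q) (a : S), δ s a ≠ some q) (x y : Option (Q ⊕ S)) :
    autMul δ x y ≠ some (Sum.inl q) := by
  rcases x with _ | (s | _) <;> rcases y with _ | (_ | a) <;> simp [autMul, hnotran]

/-- States on which all letters agree have the same left multiplication. -/
theorem autMul_congr_state {Q S : Type} {δ : Q → S → Option Q} {q r : Q}
    (hsame : ∀ a : S, δ q a = δ r a) (y : Option (Q ⊕ S)) :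
    autMul δ (some (Sum.inl q)) y = autMul δ (some (Sum.inl r)) y := by
  rcases y with _ | (_ | a) <;> simp [autMul, hsame]

theorem phiState_self {Q S : Type} (q r : Q) (hqr : q ≠ r) :
    phiState (S := S) q r hqr (some (Sum.inl q)) =
      (⟨some (Sum.inl r), by simpa using hqr.symm⟩,
        ⟨some (Sum.inl r), by simpa using hqr.symm⟩) := by
  simp [phiState]

theorem phiState_of_ne {Q S : Type} (q r : Q) (hqr : q ≠ r) {x : Option (Q ⊕ S)}
    (h : x ≠ some (Sum.inl q)) :
    phiState q r hqr x = (⟨x, h⟩, ⟨none, by simp⟩) := by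
  simp [phiState, h]

theorem phiState_injective {Q S : Type} (q r : Q) (hqr : q ≠ r) :
    Function.Injective (phiState (S := S) q r hqr) := by
  intro x y h
  by_cases hx : x = some (Sum.inl q) <;> by_cases hy : y = some (Sum.inl q)
  · rw [hx, hy]
  · subst hx
    simp [phiState_self, phiState_of_ne q r hqr hy] at h
  · subst hy
    simp [phiState_self, phiState_of_ne q r hqr hx] at h
  · simpa [phiState_of_ne q r hqr hx, phiState_of_ne q r hqr hy] using h

/-- Composing an embedding into a power with an injective homomorphism. -/
theorem EmbedsInPower.comp_injective {B C D : Type} {mB : B → B → B} {mC : C → C → C}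
    {mD : D → D → D} (h : EmbedsInPower mB mC) (f : C → D) (hf : Function.Injective f)
    (hmul : ∀ x y, f (mC x y) = mD (f x) (f y)) : EmbedsInPower mB mD := by
  obtain ⟨I, g, hg, hgm⟩ := h
  refine ⟨I, fun b i => f (g b i), fun x y hxy => hg ?_, fun x y => ?_⟩
  · funext i
    exact hf (congrFun hxy i)
  · funext i
    simp only [hgm, hmul]

/-- A magma embedding into a power of the square of `mC` embeds into a power of `mC`. -/
theorem EmbedsInPower.of_prod {B C : Type} {mB : B → B → B} {mC : C → C → C}
    (h : EmbedsInPower mB (fun u v : C × C => (mC u.1 v.1, mC u.2 v.2))) :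
    EmbedsInPower mB mC := by
  obtain ⟨I, g, hg, hgm⟩ := h
  refine ⟨I ⊕ I, fun b => Sum.elim (fun i => (g b i).1) (fun i => (g b i).2),
    fun x y hxy => hg ?_, fun x y => ?_⟩
  · funext i
    exact Prod.ext (congrFun hxy (Sum.inl i)) (congrFun hxy (Sum.inr i))
  · funext i
    cases i <;> simp [hgm]

/-- Let `M` be a finite automatic algebra with distinct states `q, r` such that `q` is in
the range of no letter and `q·a = r·a` for every letter `a`, and let `N` be the submagma
of `M` on `M ∖ {q}` (so there is a multiplication `nmul` on `N` restricting that of `M`).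
Then the explicit map `φ` with `φ x = (x, 0)` for `x ∈ N` and `φ q = (r, r)` is an
injective multiplication-preserving map from `M` into `N × N`; consequently every magma
embeds into a power of `M` iff it embeds into a power of `N`. -/
theorem remove_redundant_state
    {Q S : Type} [Fintype Q] [Fintype S]
    (δ : Q → S → Option Q) (q r : Q) (hqr : q ≠ r)
    (hnotran : ∀ (s : Q) (a : S), δ s a ≠ some q)
    (hsame : ∀ a : S, δ q a = δ r a) :
    ∃ nmul : {v : Option (Q ⊕ S) // v ≠ some (Sum.inl q)} →
        {v : Option (Q ⊕ S) // v ≠ some (Sum.inl q)} →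
        {v : Option (Q ⊕ S) // v ≠ some (Sum.inl q)},
      (∀ x y, (nmul x y : Option (Q ⊕ S)) = autMul δ (x : Option (Q ⊕ S)) y) ∧
      Function.Injective (phiState (S := S) q r hqr) ∧
      (∀ x y : Option (Q ⊕ S),
        phiState (S := S) q r hqr (autMul δ x y) =
          (nmul (phiState (S := S) q r hqr x).1 (phiState (S := S) q r hqr y).1,
           nmul (phiState (S := S) q r hqr x).2 (phiState (S := S) q r hqr y).2)) ∧
      ∀ (B : Type) (mB : B → B → B),
        EmbedsInPower mB (autMul δ) ↔ EmbedsInPower mB nmul := by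
  have hmul : ∀ x y : Option (Q ⊕ S), phiState (S := S) q r hqr (autMul δ x y) =
      (⟨autMul δ (phiState (S := S) q r hqr x).1 (phiState (S := S) q r hqr y).1,
          autMul_ne_state hnotran _ _⟩,
        ⟨autMul δ (phiState (S := S) q r hqr x).2 (phiState (S := S) q r hqr y).2,
          autMul_ne_state hnotran _ _⟩) := by
    intro x y
    rw [phiState_of_ne q r hqr (autMul_ne_state hnotran x y)]
    by_cases hx : x = some (Sum.inl q) <;> by_cases hy : y = some (Sum.inl q)
    · subst hx hy
      simp [phiState_self, autMul_inl_right]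
    · subst hx
      simp [phiState_self, phiState_of_ne q r hqr hy, autMul_none_right,
        autMul_congr_state hsame]
    · subst hy
      simp [phiState_self, phiState_of_ne q r hqr hx, autMul_inl_right]
    · simp [phiState_of_ne q r hqr hx, phiState_of_ne q r hqr hy, autMul_none_right]
  refine ⟨fun x y => ⟨autMul δ x y, autMul_ne_state hnotran _ _⟩, fun _ _ => rfl,
    phiState_injective q r hqr, hmul, fun B mB => ⟨fun h => ?_, fun h => ?_⟩⟩
  · exact (h.comp_injective _ (phiState_injective q r hqr) hmul).of_prod
  · exact h.comp_injective Subtype.val Subtype.val_injective fun _ _ => rfl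
end

section
/- Let G be a finite abelian group, let H be a subgroup of G, and let a ∈ G be such that the image of a in G⧸H generates G⧸H. Let n be the index of H in G and set u := a^n (note u ∈ H). Then every group endomorphism φ of H with φ(u) = u extends to a group endomorphism ξ of G such that ξ(h) = φ(h) for all h ∈ H and ξ maps the coset aH into itself (in particular ξ(a) ∈ aH). Explicitly, ξ(a^t * h) = a^t * φ(h) for t ∈ ℤ and h ∈ H is well defined and has these properties. -/
/-- If the image of `a` generates `G ⧸ H`, a power of `a` lies in `H` exactly when the index
of `H` divides the exponent. -/
theorem zpow_mem_iff_index_dvd {G : Type*} [CommGroup G] (H : Subgroup G) (a : G)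
    (ha : ∀ x : G ⧸ H, x ∈ Subgroup.zpowers (QuotientGroup.mk a : G ⧸ H)) (t : ℤ) :
    a ^ t ∈ H ↔ (H.index : ℤ) ∣ t := by
  rw [Subgroup.index, ← orderOf_eq_card_of_forall_mem_zpowers ha, orderOf_dvd_iff_zpow_eq_one,
    ← QuotientGroup.mk_zpow, QuotientGroup.eq_one_iff]

/-- If the image of `a` generates `G ⧸ H`, every element of `G` is a power of `a` times an
element of `H`. -/
theorem exists_eq_zpow_mul {G : Type*} [CommGroup G] (H : Subgroup G) (a : G)
    (ha : ∀ x : G ⧸ H, x ∈ Subgroup.zpowers (QuotientGroup.mk a : G ⧸ H)) (x : G) :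
    ∃ (t : ℤ) (h : H), x = a ^ t * h := by
  obtain ⟨t, ht⟩ := Subgroup.mem_zpowers_iff.mp (ha x)
  rw [← QuotientGroup.mk_zpow, QuotientGroup.eq] at ht
  exact ⟨t, ⟨_, ht⟩, by simp⟩

/-- The value `a ^ t * φ h` depends only on the element `a ^ t * h`. -/
theorem zpow_mul_map_eq_of_zpow_mul_eq {G : Type*} [CommGroup G] (H : Subgroup G) (a : G)
    (ha : ∀ x : G ⧸ H, x ∈ Subgroup.zpowers (QuotientGroup.mk a : G ⧸ H))
    (hu : a ^ H.index ∈ H) (φ : H →* H) (hφ : φ ⟨a ^ H.index, hu⟩ = ⟨a ^ H.index, hu⟩)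
    {t s : ℤ} {h k : H} (e : a ^ t * (h : G) = a ^ s * (k : G)) :
    a ^ t * (φ h : G) = a ^ s * (φ k : G) := by
  have hk : (k : G) = a ^ (t - s) * h := by
    rw [sub_eq_neg_add, zpow_add, mul_assoc, e, zpow_neg, inv_mul_cancel_left]
  have hmem : a ^ (t - s) ∈ H := by
    rw [← mul_inv_eq_of_eq_mul hk]
    exact H.mul_mem k.2 (H.inv_mem h.2)
  obtain ⟨m, hm⟩ := (zpow_mem_iff_index_dvd H a ha _).mp hmem
  have hk' : k = (⟨a ^ H.index, hu⟩ : H) ^ m * h := by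
    ext
    simp [hk, hm, zpow_mul]
  rw [hk', map_mul, map_zpow, hφ]
  obtain rfl : t = s + H.index * m := by lia
  simp [zpow_add, zpow_mul, mul_assoc]

/-- Let `G` be a finite abelian group, `H ≤ G`, and `a ∈ G` whose image in `G ⧸ H`
generates `G ⧸ H`.  Let `n = [G : H]` and `u = a ^ n` (which lies in `H`).  Then every
endomorphism `φ` of `H` fixing `u` extends to an endomorphism `ξ` of `G` which agrees
with `φ` on `H`, maps the coset `aH` into itself, and satisfies
`ξ (a ^ t * h) = a ^ t * φ h` for all `t ∈ ℤ` and `h ∈ H`. -/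
theorem extend_endomorphism_fixing_u
    {G : Type} [CommGroup G] [Fintype G] (H : Subgroup G) (a : G)
    (ha : ∀ x : G ⧸ H, x ∈ Subgroup.zpowers (QuotientGroup.mk a : G ⧸ H)) :
    ∃ hu : a ^ H.index ∈ H,
      ∀ φ : H →* H, φ ⟨a ^ H.index, hu⟩ = ⟨a ^ H.index, hu⟩ →
        ∃ ξ : G →* G,
          (∀ h : H, ξ (h : G) = ((φ h : H) : G)) ∧
          (∀ h : H, ξ (a * (h : G)) ∈ (fun x : G => a * x) '' (H : Set G)) ∧
          (∀ (t : ℤ) (h : H), ξ (a ^ t * (h : G)) = a ^ t * ((φ h : H) : G)) := by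
  have hu : a ^ H.index ∈ H := by
    simpa using (zpow_mem_iff_index_dvd H a ha H.index).mpr dvd_rfl
  refine ⟨hu, fun φ hφ => ?_⟩
  choose t h hth using exists_eq_zpow_mul H a ha
  have key : ∀ (x : G) (s : ℤ) (k : H), x = a ^ s * k →
      a ^ t x * (φ (h x) : G) = a ^ s * (φ k : G) := fun x s k e =>
    zpow_mul_map_eq_of_zpow_mul_eq H a ha hu φ hφ ((hth x).symm.trans e)
  let ξ : G →* G := MonoidHom.mk' (fun x => a ^ t x * (φ (h x) : G)) fun x y => by
    rw [key (x * y) (t x + t y) (h x * h y), map_mul, Subgroup.coe_mul, zpow_add, mul_mul_mul_comm]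
    rw [Subgroup.coe_mul, zpow_add, mul_mul_mul_comm, ← hth, ← hth]
  have hξ : ∀ (s : ℤ) (k : H), ξ (a ^ s * (k : G)) = a ^ s * ((φ k : H) : G) :=
    fun s k => key _ s k rfl
  exact ⟨ξ, fun k => by simpa using hξ 0 k,
    fun k => ⟨φ k, (φ k).2, by simpa using (hξ 1 k).symm⟩, hξ⟩
end

section
/- Let m ≥ 1 and let H be a finite abelian group whose exponent divides m, and let u ∈ H. Then there is a group homomorphism χ : H → ℤ/mℤ such that for every h ∈ H with h ≠ 1 there exists a group endomorphism φ of H with φ(u) = u and χ(φ(h)) ≠ 0. -/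
/-- Any two nontrivial elements of a finite abelian group are simultaneously detected by a single
complex character. -/
theorem exists_character_ne_one_of_pair {H : Type*} [CommGroup H] [Finite H] (a b : H) :
    ∃ χ : H →* ℂˣ, (a ≠ 1 → χ a ≠ 1) ∧ (b ≠ 1 → χ b ≠ 1) := by
  have separate (c : H) : ∃ χ : H →* ℂˣ, c ≠ 1 → χ c ≠ 1 := by
    by_cases hc : c = 1
    · exact ⟨1, fun h => absurd hc h⟩
    · obtain ⟨χ, hχ⟩ := CommGroup.exists_apply_ne_one_of_hasEnoughRootsOfUnity H ℂ hc
      exact ⟨χ, fun _ => hχ⟩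
  obtain ⟨α, hα⟩ := separate a
  obtain ⟨β, hβ⟩ := separate b
  by_cases hαb : b ≠ 1 → α b ≠ 1
  · exact ⟨α, hα, hαb⟩
  by_cases hβa : a ≠ 1 → β a ≠ 1
  · exact ⟨β, hβa, hβ⟩
  push Not at hαb hβa
  exact ⟨α * β, fun ha => by simpa [hβa.2] using hα ha, fun hb => by simpa [hαb.2] using hβ hb⟩

/-- Characters chosen separately for each prime can be glued to a single character which is
nontrivial on an element of order `p` as soon as the character chosen for `p` is. -/
theorem exists_character_ne_one_of_pow_prime {H : Type*} [CommGroup H] [Finite H]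
    (χ : ℕ → H →* ℂˣ) :
    ∃ ψ : H →* ℂˣ, ∀ (p : ℕ) (a : H), p.Prime → a ^ p = 1 → χ p a ≠ 1 → ψ a ≠ 1 := by
  set N := Nat.card H
  have hN0 : N ≠ 0 := Nat.card_pos.ne'
  refine ⟨∏ q ∈ N.primeFactors, χ q ^ (ordCompl[q] N), fun p a hp hap hχ h => hχ ?_⟩
  have hpow (q : ℕ) : χ q a ^ p = 1 := by rw [← map_pow, hap, map_one]
  have hpN : p ∣ N := by
    have ha : a ≠ 1 := fun ha => hχ (by rw [ha, map_one])
    have := Fact.mk hp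
    rw [← orderOf_eq_prime hap ha]
    exact orderOf_dvd_natCard a
  have hprod : (∏ q ∈ N.primeFactors, χ q ^ (ordCompl[q] N)) a = χ p a ^ (ordCompl[p] N) := by
    rw [MonoidHom.finsetProd_apply]
    refine Finset.prod_eq_single p (fun q hq hqp => ?_) (fun hpn => ?_)
    · have hq' := Nat.prime_of_mem_primeFactors hq
      have hdvd : p ∣ ordCompl[q] N := by
        have hcop : Nat.Coprime p (q ^ N.factorization q) :=
          Nat.Coprime.pow_right _ ((Nat.coprime_primes hp hq').2 (Ne.symm hqp))
        refine hcop.dvd_of_dvd_mul_left ?_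
        rwa [Nat.ordProj_mul_ordCompl_eq_self]
      obtain ⟨k, hk⟩ := hdvd
      rw [MonoidHom.pow_apply, hk, pow_mul, hpow, one_pow]
    · exact absurd (Nat.mem_primeFactors.2 ⟨hp, hpN, hN0⟩) hpn
  rw [hprod] at h
  have hcop : Nat.Coprime p (ordCompl[p] N) := Nat.coprime_ordCompl hp hN0
  have := orderOf_dvd_of_pow_eq_one h
  rw [← orderOf_eq_one_iff]
  exact Nat.eq_one_of_dvd_coprimes hcop (orderOf_dvd_of_pow_eq_one (hpow p)) this

/-- For any two elements of a finite abelian group there is a complex character preserving the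
orders of both. -/
theorem exists_character_orderOf_eq {H : Type*} [CommGroup H] [Finite H] (u x : H) :
    ∃ χ : H →* ℂˣ, orderOf (χ u) = orderOf u ∧ orderOf (χ x) = orderOf x := by
  choose χ hχu hχx using fun p : ℕ =>
    exists_character_ne_one_of_pair (u ^ (orderOf u / p)) (x ^ (orderOf x / p))
  obtain ⟨ψ, hψ⟩ := exists_character_ne_one_of_pow_prime χ
  have key (y : H) (hy : ∀ p, y ^ (orderOf y / p) ≠ 1 → χ p (y ^ (orderOf y / p)) ≠ 1) :
      orderOf (ψ y) = orderOf y := by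
    refine orderOf_eq_of_pow_and_pow_div_prime (orderOf_pos y)
      (by rw [← map_pow, pow_orderOf_eq_one, map_one]) fun p hp hpd => ?_
    rw [← map_pow]
    refine hψ p _ hp ?_ (hy p ?_)
    · rw [← pow_mul, Nat.div_mul_cancel hpd, pow_orderOf_eq_one]
    · exact pow_ne_one_of_lt_orderOf
        (Nat.div_pos (Nat.le_of_dvd (orderOf_pos y) hpd) hp.pos).ne'
        (Nat.div_lt_self (orderOf_pos y) hp.one_lt)
  exact ⟨ψ, key u hχu, key x hχx⟩

/-- If the character `χ` takes a value of order `exponent H`, then every complex character of `H`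
factors through `χ`. -/
theorem exists_comp_eq_of_orderOf_eq_exponent {H : Type*} [CommGroup H] [Finite H]
    (χ : H →* ℂˣ) (x : H) (hx : orderOf (χ x) = Monoid.exponent H) (ψ : H →* ℂˣ) :
    ∃ n : H →* H, χ.comp n = ψ ∧ ψ.ker ≤ n.ker := by
  set e := Monoid.exponent H
  have he0 : e ≠ 0 := Monoid.exponent_ne_zero_of_finite
  have : NeZero e := ⟨he0⟩
  have hxe : orderOf x = e :=
    Nat.dvd_antisymm (Monoid.order_dvd_exponent x) (hx ▸ orderOf_map_dvd χ x)
  have hmem (θ : H →* ℂˣ) (h : H) : θ h ∈ rootsOfUnity e ℂ := by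
    rw [mem_rootsOfUnity, ← map_pow, Monoid.pow_exponent_eq_one, map_one]
  let f : Subgroup.zpowers x →* rootsOfUnity e ℂ :=
    (χ.codRestrict _ (hmem χ)).comp (Subgroup.zpowers x).subtype
  have hf : Function.Injective f := by
    rw [injective_iff_map_eq_one]
    rintro ⟨_, k, rfl⟩ hk
    have hk' : χ x ^ k = 1 := by
      rw [← map_zpow]
      exact congrArg Subtype.val hk
    rw [← orderOf_dvd_iff_zpow_eq_one, hx, ← hxe, orderOf_dvd_iff_zpow_eq_one] at hk'
    exact Subtype.ext hk'
  have hcard : Nat.card (Subgroup.zpowers x) = Nat.card (rootsOfUnity e ℂ) := by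
    rw [Nat.card_zpowers, hxe, HasEnoughRootsOfUnity.natCard_rootsOfUnity]
  let E := MulEquiv.ofBijective f ((Nat.bijective_iff_injective_and_card f).2 ⟨hf, hcard⟩)
  refine ⟨(Subgroup.zpowers x).subtype.comp
    (E.symm.toMonoidHom.comp (ψ.codRestrict _ (hmem ψ))), ?_, fun h hh => ?_⟩
  · ext1 h
    exact congrArg Subtype.val (E.apply_symm_apply (ψ.codRestrict _ (hmem ψ) h))
  · have : ψ.codRestrict _ (hmem ψ) h = 1 := Subtype.ext hh
    simp [MonoidHom.mem_ker, this]

/-- An element of order preserved by `χ` generates a subgroup meeting the kernel trivially. -/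
theorem eq_one_of_mem_zpowers_of_map_eq_one {G M : Type*} [Group G] [Group M] (χ : G →* M)
    {u h : G} (hu : orderOf (χ u) = orderOf u) (hh : h ∈ Subgroup.zpowers u) (h1 : χ h = 1) :
    h = 1 := by
  obtain ⟨k, rfl⟩ := hh
  simp only [map_zpow] at h1
  rwa [← orderOf_dvd_iff_zpow_eq_one, hu, orderOf_dvd_iff_zpow_eq_one] at h1

/-- Complex-valued form of `exists_character_detecting_via_endomorphisms`. -/
theorem exists_complex_character_detecting_via_endomorphisms {H : Type*} [CommGroup H] [Finite H]
    (u : H) : ∃ χ : H →* ℂˣ, ∀ h : H, h ≠ 1 → ∃ φ : H →* H, φ u = u ∧ χ (φ h) ≠ 1 := by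
  obtain ⟨x, hx⟩ := Monoid.exists_orderOf_eq_exponent
    (Monoid.ExponentExists.of_finite (G := H))
  obtain ⟨χ, hχu, hχx⟩ := exists_character_orderOf_eq u x
  refine ⟨χ, fun h hh => ?_⟩
  by_cases hχh : χ h = 1
  · have hmem : (h : H ⧸ Subgroup.zpowers u) ≠ 1 := fun h1 =>
      hh (eq_one_of_mem_zpowers_of_map_eq_one χ hχu ((QuotientGroup.eq_one_iff h).1 h1) hχh)
    obtain ⟨θ, hθ⟩ := CommGroup.exists_apply_ne_one_of_hasEnoughRootsOfUnity _ ℂ hmem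
    obtain ⟨n, hn, hker⟩ := exists_comp_eq_of_orderOf_eq_exponent χ x (hχx.trans hx)
      (θ.comp (QuotientGroup.mk' (Subgroup.zpowers u)))
    have hnu : n u = 1 := hker <| by
      have : (u : H ⧸ Subgroup.zpowers u) = 1 :=
        (QuotientGroup.eq_one_iff u).2 (Subgroup.mem_zpowers u)
      simp [MonoidHom.mem_ker, this]
    refine ⟨MonoidHom.id H * n, by simp [hnu], ?_⟩
    have hnh : χ (n h) = θ h := DFunLike.congr_fun hn h
    simpa [hχh, hnh] using hθ
  · exact ⟨MonoidHom.id H, rfl, hχh⟩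


/-- Let `m ≥ 1` and let `H` be a finite abelian group of exponent dividing `m`, and let
`u ∈ H`.  Then there is a homomorphism `χ : H → ℤ/mℤ` such that for every `h ≠ 1` in `H`
there is an endomorphism `φ` of `H` with `φ u = u` and `χ (φ h) ≠ 0`. -/
theorem exists_character_detecting_via_endomorphisms
    {H : Type} [CommGroup H] [Fintype H] (m : ℕ) (hm : 1 ≤ m)
    (hexp : ∀ h : H, h ^ m = 1) (u : H) :
    ∃ χ : H →* Multiplicative (ZMod m),
      ∀ h : H, h ≠ 1 → ∃ φ : H →* H, φ u = u ∧
        Multiplicative.toAdd (χ (φ h)) ≠ (0 : ZMod m) := by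
  have : NeZero m := ⟨by lia⟩
  obtain ⟨χ, hχ⟩ := exists_complex_character_detecting_via_endomorphisms u
  have hmem (h : H) : χ h ∈ rootsOfUnity m ℂ := by
    rw [mem_rootsOfUnity, ← map_pow, hexp, map_one]
  have hcard : Nat.card (rootsOfUnity m ℂ) = Nat.card (Multiplicative (ZMod m)) := by
    rw [HasEnoughRootsOfUnity.natCard_rootsOfUnity]
    simp
  let E : rootsOfUnity m ℂ ≃* Multiplicative (ZMod m) := mulEquivOfCyclicCardEq hcard
  refine ⟨E.toMonoidHom.comp (χ.codRestrict _ hmem), fun h hh => ?_⟩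
  obtain ⟨φ, hφu, hφ⟩ := hχ h hh
  refine ⟨φ, hφu, fun h0 => hφ ?_⟩
  have h1 : E (χ.codRestrict _ hmem (φ h)) = 1 := h0
  exact congrArg Subtype.val ((map_eq_one_iff E E.injective).1 h1)
end

section
/- Let m ≥ 1 and k ≥ 1, and let H be a subgroup of (ℤ/mℤ)^k. Then H can be described as the set of solutions in ℤ/mℤ of a system of homogeneous linear equations with integer coefficients: there exist ℓ ∈ ℕ and vectors c⁽¹⁾, …, c⁽ℓ⁾ ∈ ℤ^k such that H = { x ∈ (ℤ/mℤ)^k : ∀ j ∈ {1,…,ℓ}, Σ_{i=1}^{k} c⁽ʲ⁾_i • x_i = 0 }. -/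
lemma AddChar.map_sum_eq_prod {A M ι : Type*} [AddCommMonoid A] [CommMonoid M]
    (ψ : AddChar A M) (s : Finset ι) (f : ι → A) : ψ (∑ i ∈ s, f i) = ∏ i ∈ s, ψ (f i) :=
  map_prod ψ.toMonoidHom (fun i ↦ Multiplicative.ofAdd (f i)) s

open ZMod in
/-- Every complex character of `ℤ/mℤ` is a multiple of the standard one. -/
lemma exists_eq_stdAddChar_intCast_mul {m : ℕ} [NeZero m] (ψ : AddChar (ZMod m) ℂ) :
    ∃ c : ℤ, ∀ x, ψ x = stdAddChar ((c : ZMod m) * x) := by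
  obtain ⟨a, rfl⟩ := (AddChar.zmodAddEquiv (n := m)).surjective ψ
  obtain ⟨c, rfl⟩ := ZMod.intCast_surjective a
  exact ⟨c, fun x ↦ rfl⟩

/-- A linear form over `ℤ/mℤ` vanishing on the subgroup `H` but not at `x ∉ H`. -/
lemma exists_sum_zsmul_ne_zero {m : ℕ} [NeZero m] {ι : Type*} [Fintype ι]
    (H : AddSubgroup (ι → ZMod m)) {x : ι → ZMod m} (hx : x ∉ H) :
    ∃ c : ι → ℤ, (∀ y ∈ H, ∑ i, c i • y i = 0) ∧ ∑ i, c i • x i ≠ 0 := by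
  classical
  have hne : (x : (ι → ZMod m) ⧸ H) ≠ 0 := by rwa [Ne, QuotientAddGroup.eq_zero_iff]
  obtain ⟨ψ, hψ⟩ := AddChar.exists_apply_ne_zero.2 hne
  let φ : AddChar (ι → ZMod m) ℂ := ψ.compAddMonoidHom (QuotientAddGroup.mk' H)
  choose c hc using fun i ↦ exists_eq_stdAddChar_intCast_mul
    (φ.compAddMonoidHom (AddMonoidHom.single (fun _ ↦ ZMod m) i))
  have key (y : ι → ZMod m) : φ y = ZMod.stdAddChar (∑ i, c i • y i) := by
    conv_lhs => rw [← Finset.univ_sum_single y]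
    rw [AddChar.map_sum_eq_prod, AddChar.map_sum_eq_prod]
    refine Finset.prod_congr rfl fun i _ ↦ ?_
    rw [zsmul_eq_mul, ← hc]
    rfl
  refine ⟨c, fun y hy ↦ ZMod.injective_stdAddChar ?_, fun h ↦ hψ ?_⟩
  · rw [← key, AddChar.map_zero_eq_one]
    change ψ (y : (ι → ZMod m) ⧸ H) = 1
    rw [(QuotientAddGroup.eq_zero_iff y).2 hy, AddChar.map_zero_eq_one]
  · change φ x = 1
    rw [key, h, AddChar.map_zero_eq_one]

/-- Every subgroup `H` of `(ℤ/mℤ)^k` is the solution set of a system of homogeneous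
linear equations with integer coefficients: there are `ℓ ∈ ℕ` and vectors
`c⁽¹⁾, …, c⁽ℓ⁾ ∈ ℤ^k` with `H = { x : ∀ j, ∑ i, c⁽ʲ⁾ᵢ • xᵢ = 0 }`. -/
theorem subgroup_eq_solution_set (m k : ℕ) (hm : 1 ≤ m) (hk : 1 ≤ k)
    (H : AddSubgroup (Fin k → ZMod m)) :
    ∃ (ℓ : ℕ) (c : Fin ℓ → Fin k → ℤ),
      (H : Set (Fin k → ZMod m)) =
        {x : Fin k → ZMod m | ∀ j : Fin ℓ, ∑ i : Fin k, c j i • x i = 0} := by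
  have : NeZero m := ⟨by omega⟩
  choose c hcH hcx using fun x : {x // x ∉ H} ↦ exists_sum_zsmul_ne_zero H x.2
  let e := Finite.equivFin {x // x ∉ H}
  refine ⟨_, fun j ↦ c (e.symm j), Set.ext fun x ↦ ⟨fun hx j ↦ hcH _ x hx, fun h ↦ ?_⟩⟩
  by_contra hx
  exact hcx ⟨x, hx⟩ (by simpa using h (e ⟨x, hx⟩))
end

section
/- Let m ≥ 1 and let M be a j × k matrix over ℤ/mℤ such that: the set of rows of M forms a subgroup of (ℤ/mℤ)^k; the set of columns of M forms a coset of a subgroup of (ℤ/mℤ)^j; and every row of M contains at least one entry equal to 0. Then some column of M is constantly 0. -/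
theorem addChar_sum_eq_prod {A R ι : Type*} [AddCommMonoid A] [CommMonoid R]
    (ψ : AddChar A R) (s : Finset ι) (f : ι → A) :
    ψ (∑ i ∈ s, f i) = ∏ i ∈ s, ψ (f i) :=
  map_prod ψ.toMonoidHom (fun i => Multiplicative.ofAdd (f i)) s

/-- A vector outside a subgroup `C` of `(ℤ/mℤ)^ι` is separated from `C` by a linear form. -/
theorem exists_sum_mul_eq_zero_and_ne_zero {ι : Type*} [Fintype ι] {m : ℕ} [NeZero m]
    (C : AddSubgroup (ι → ZMod m)) {v : ι → ZMod m} (hv : v ∉ C) :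
    ∃ a : ι → ZMod m, (∀ c ∈ C, ∑ i, a i * c i = 0) ∧ ∑ i, a i * v i ≠ 0 := by
  classical
  have hq : (QuotientAddGroup.mk v : (ι → ZMod m) ⧸ C) ≠ 0 := by
    rwa [Ne, QuotientAddGroup.eq_zero_iff]
  obtain ⟨ψ, hψ⟩ := AddChar.exists_apply_ne_zero.mpr hq
  let χ : AddChar (ι → ZMod m) ℂ := ψ.compAddMonoidHom (QuotientAddGroup.mk' C)
  have hζ := Complex.isPrimitiveRoot_exp m (NeZero.ne m)
  set ζ := Complex.exp (2 * Real.pi * Complex.I / m)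
  have hroot (i : ι) : ∃ n < m, ζ ^ n = χ (Pi.single i 1) := by
    apply hζ.eq_pow_of_pow_eq_one
    rw [← AddChar.map_nsmul_eq_pow, ← Pi.single_smul]
    simp
  choose n _ hn using hroot
  have hχ (x : ι → ZMod m) : χ x = ζ ^ (∑ i, n i * (x i).val) := by
    have hx : x = ∑ i, (x i).val • (Pi.single i 1 : ι → ZMod m) := by
      simp_rw [← Pi.single_smul, nsmul_eq_mul, mul_one, ZMod.natCast_zmod_val]
      exact (Finset.univ_sum_single x).symm
    conv_lhs => rw [hx]
    rw [addChar_sum_eq_prod, ← Finset.prod_pow_eq_pow_sum]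
    refine Finset.prod_congr rfl fun i _ => ?_
    rw [AddChar.map_nsmul_eq_pow, ← hn, pow_mul]
  have hiff (x : ι → ZMod m) : ∑ i, (n i : ZMod m) * x i = 0 ↔ χ x = 1 := by
    rw [hχ, hζ.pow_eq_one_iff_dvd, ← ZMod.natCast_eq_zero_iff]
    push_cast
    simp_rw [ZMod.natCast_zmod_val]
  refine ⟨fun i => n i, fun c hc => (hiff c).mpr ?_, fun h => hψ ((hiff v).mp h)⟩
  have : (QuotientAddGroup.mk c : (ι → ZMod m) ⧸ C) = 0 :=
    (QuotientAddGroup.eq_zero_iff c).mpr hc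
  simp [χ, this]

/-- Let `M` be a `j × k` matrix over `ℤ/mℤ` whose rows form a subgroup of `(ℤ/mℤ)^k`,
whose columns form a coset of a subgroup of `(ℤ/mℤ)^j`, and such that every row contains
at least one `0`.  Then some column of `M` is constantly `0`. -/
theorem exists_zero_column (m j k : ℕ) (hm : 1 ≤ m) (M : Fin j → Fin k → ZMod m)
    (hrows : ∃ R : AddSubgroup (Fin k → ZMod m),
      Set.range M = (R : Set (Fin k → ZMod m)))
    (hcols : ∃ (C : AddSubgroup (Fin j → ZMod m)) (v : Fin j → ZMod m),
      Set.range (fun l : Fin k => fun i : Fin j => M i l) =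
        (fun x => v + x) '' (C : Set (Fin j → ZMod m)))
    (hzero : ∀ i : Fin j, ∃ l : Fin k, M i l = 0) :
    ∃ l : Fin k, ∀ i : Fin j, M i l = 0 := by
  have : NeZero m := ⟨by omega⟩
  obtain ⟨R, hR⟩ := hrows
  obtain ⟨C, v, hC⟩ := hcols
  by_cases hv : v ∈ C
  · have h0 : (0 : Fin j → ZMod m) ∈ Set.range (fun l : Fin k => fun i : Fin j => M i l) := by
      rw [hC]
      exact ⟨-v, C.neg_mem hv, add_neg_cancel v⟩
    obtain ⟨l, hl⟩ := h0
    exact ⟨l, fun i => congrFun hl i⟩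
  · exfalso
    obtain ⟨a, haC, hav⟩ := exists_sum_mul_eq_zero_and_ne_zero C hv
    have hmem : ∑ i, (a i).val • M i ∈ (R : Set (Fin k → ZMod m)) :=
      R.sum_mem fun i _ => R.nsmul_mem (hR ▸ Set.mem_range_self i : M i ∈ (R : Set _)) _
    rw [← hR] at hmem
    obtain ⟨r, hr⟩ := hmem
    obtain ⟨l, hl⟩ := hzero r
    have hcol : (fun i => M i l) ∈ (fun x => v + x) '' (C : Set (Fin j → ZMod m)) :=
      hC ▸ Set.mem_range_self l
    obtain ⟨c, hc, hvc⟩ := hcol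
    apply hav
    calc ∑ i, a i * v i = ∑ i, a i * (v + c) i := by
          simp [mul_add, Finset.sum_add_distrib, haC c hc]
      _ = ∑ i, a i * M i l := by
          rw [show v + c = fun i => M i l from hvc]
      _ = M r l := by
          rw [hr, Finset.sum_apply]
          refine Finset.sum_congr rfl fun i _ => ?_
          rw [Pi.smul_apply, nsmul_eq_mul, ZMod.natCast_zmod_val]
      _ = 0 := hl
end

section
/- Let M be a finite automatic algebra with exactly two states, |Q| = 2. Then M satisfies the equations x·y = ((x·y)·y)·y and ((w·x)·y)·z = ((w·y)·x)·z (for all elements w, x, y, z ∈ M) if and only if none of the six automatic algebras N₀, N₁, N₂, N₃, N₄, N₅ admits an injective multiplication-preserving map into M. -/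
/-- There is an injective multiplication-preserving map from `(B, mB)` into `(C, mC)`. -/
def MagEmbeds {B C : Type} (mB : B → B → B) (mC : C → C → C) : Prop :=
  ∃ f : B → C, Function.Injective f ∧ ∀ x y : B, f (mB x y) = mC (f x) (f y)

/-- `N₀`: states `0 = q`, `1 = r`, one letter `a` with `q·a = r`. -/
def N0δ : Fin 2 → Fin 1 → Option (Fin 2) := fun s _ => if s = 0 then some 1 else none

/-- `N₁`: letters `0 = a`, `1 = b`; `q·a = r`, `r·a = r`, `r·b = r`. -/
def N1δ : Fin 2 → Fin 2 → Option (Fin 2) := fun s l =>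
  if s = 0 ∧ l = 1 then none else some 1

/-- `N₂`: letters `0 = a`, `1 = b`; `q·a = r`, `r·a = q`, `r·b = r`. -/
def N2δ : Fin 2 → Fin 2 → Option (Fin 2) := fun s l =>
  if l = 0 then some (if s = 0 then 1 else 0) else if s = 1 then some 1 else none

/-- `N₃`: letters `0 = a`, `1 = b`; `q·a = r`, `r·a = r`, `q·b = q`. -/
def N3δ : Fin 2 → Fin 2 → Option (Fin 2) := fun s l =>
  if l = 0 then some 1 else if s = 0 then some 0 else none

/-- `N₄`: letters `0 = a`, `1 = b`; `q·a = r`, `r·a = r`, `q·b = r`, `r·b = q`. -/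
def N4δ : Fin 2 → Fin 2 → Option (Fin 2) := fun s l =>
  if l = 0 then some 1 else some (if s = 0 then 1 else 0)

/-- `N₅`: letters `0 = a`, `1 = b`, `2 = c`;
`q·a = r`, `r·a = r`, `q·b = q`, `r·b = q`, `q·c = q`, `r·c = r`. -/
def N5δ : Fin 2 → Fin 3 → Option (Fin 2) := fun s l =>
  if l = 0 then some 1 else if l = 1 then some 0 else some s

/-- The two defining equations of the theorem, `x·y = ((x·y)·y)·y` and
`((w·x)·y)·z = ((w·y)·x)·z`, for a multiplication `m`. -/
def SatisfiesEquations {B : Type} (m : B → B → B) : Prop :=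
  (∀ x y, m x y = m (m (m x y) y) y) ∧
    ∀ w x y z, m (m (m w x) y) z = m (m (m w y) x) z

lemma MagEmbeds.satisfiesEquations {B C : Type} {mB : B → B → B} {mC : C → C → C}
    (h : MagEmbeds mB mC) (hC : SatisfiesEquations mC) : SatisfiesEquations mB := by
  obtain ⟨f, hf, hm⟩ := h
  refine ⟨fun x y => hf ?_, fun w x y z => hf ?_⟩
  · simpa only [hm] using hC.1 (f x) (f y)
  · simpa only [hm] using hC.2 (f w) (f x) (f y) (f z)

/-- A relabelling of states and letters compatible with the transitions is an embedding, as soon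
as it is injective on states and distinct letters of the source act differently. -/
lemma magEmbeds_autMul {P T Q S : Type} {ν : P → T → Option P} {δ : Q → S → Option Q}
    (hν : ∀ a b, (∀ p, ν p a = ν p b) → a = b) (s : P → Q) (l : T → S)
    (hs : Function.Injective s) (h : ∀ p a, δ (s p) (l a) = (ν p a).map s) :
    MagEmbeds (autMul ν) (autMul δ) := by
  have hl : Function.Injective l := fun a b hab =>
    hν a b fun p => Option.map_injective hs (by rw [← h, ← h, hab])
  refine ⟨Option.map (Sum.map s l), Option.map_injective (hs.sumMap hl), ?_⟩
  rintro (_ | p | a) (_ | p' | a') <;> try rfl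
  simp [autMul, h, Function.comp_def]

lemma autMul_cubed {Q S : Type} {δ : Q → S → Option Q} {p r : Q} (hpr : p ≠ r)
    (hall : ∀ x, x = p ∨ x = r)
    (h0 : ∀ q q' a, q ≠ q' → ¬ (δ q a = some q' ∧ δ q' a = none)) (x y : Option (Q ⊕ S)) :
    autMul δ x y = autMul δ (autMul δ (autMul δ x y) y) y := by
  rcases x with _ | q | a <;> rcases y with _ | q' | a' <;> try rfl
  simp only [autMul]
  rcases h : δ q a' with _ | q'
  · rfl
  · rcases h' : δ q' a' with _ | q''
    · grind
    · simp [h']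
      grind [autMul, hall q, hall q', hall q'']

lemma autMul_map_inl_inr {Q S : Type} (δ : Q → S → Option Q) (o : Option Q) (a : S) :
    autMul δ (o.map Sum.inl) (some (Sum.inr a)) = (o.bind (δ · a)).map Sum.inl := by
  cases o <;> rfl

/-- In the absence of `N₀`, each letter acts in one of seven ways on two states. -/
lemma transition_cases {Q S : Type} {δ : Q → S → Option Q} {p r : Q} (hpr : p ≠ r)
    (hall : ∀ x, x = p ∨ x = r)
    (h0 : ∀ q q' a, q ≠ q' → ¬ (δ q a = some q' ∧ δ q' a = none)) (a : S) :
    (δ p a = none ∧ δ r a = none) ∨ (δ p a = some p ∧ δ r a = none) ∨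
      (δ p a = none ∧ δ r a = some r) ∨ (δ p a = some p ∧ δ r a = some r) ∨
      (δ p a = some p ∧ δ r a = some p) ∨ (δ p a = some r ∧ δ r a = some r) ∨
      (δ p a = some r ∧ δ r a = some p) := by
  have hp := h0 p r a hpr
  have hr := h0 r p a hpr.symm
  rcases h : δ p a with _ | x <;> rcases h' : δ r a with _ | y
  · simp
  · rcases hall y with rfl | rfl <;> simp_all
  · rcases hall x with rfl | rfl <;> simp_all
  · rcases hall x with rfl | rfl <;> rcases hall y with rfl | rfl <;> simp


/-- Let `M` be a finite automatic algebra with exactly two states.  Then `M` satisfies the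
equations `x·y = ((x·y)·y)·y` and `((w·x)·y)·z = ((w·y)·x)·z` if and only if none of the
six automatic algebras `N₀, …, N₅` admits an injective multiplication-preserving map
into `M`. -/
theorem two_state_equations_iff_no_forbidden_subalgebras
    {Q S : Type} [Fintype Q] [Fintype S] (hQ : Fintype.card Q = 2)
    (δ : Q → S → Option Q) :
    ((∀ x y : Option (Q ⊕ S),
        autMul δ x y = autMul δ (autMul δ (autMul δ x y) y) y) ∧
     (∀ w x y z : Option (Q ⊕ S),
        autMul δ (autMul δ (autMul δ w x) y) z =
          autMul δ (autMul δ (autMul δ w y) x) z)) ↔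
    (¬ MagEmbeds (autMul N0δ) (autMul δ) ∧
     ¬ MagEmbeds (autMul N1δ) (autMul δ) ∧
     ¬ MagEmbeds (autMul N2δ) (autMul δ) ∧
     ¬ MagEmbeds (autMul N3δ) (autMul δ) ∧
     ¬ MagEmbeds (autMul N4δ) (autMul δ) ∧
     ¬ MagEmbeds (autMul N5δ) (autMul δ)) := by
  classical
  constructor
  · intro h
    refine ⟨?_, ?_, ?_, ?_, ?_, ?_⟩ <;> intro hN <;>
      exact absurd (hN.satisfiesEquations h) (by unfold SatisfiesEquations; decide)
  · rintro ⟨h0, h1, h2, h3, h4, h5⟩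
    obtain ⟨p, r, hpr, hu⟩ := Finset.card_eq_two.mp (Finset.card_univ.trans hQ)
    have hall : ∀ x, x = p ∨ x = r := fun x => by simpa [hu] using Finset.mem_univ x
    have inj {q q' : Q} (h : q ≠ q') : Function.Injective ![q, q'] := by
      simpa [Function.Injective, Fin.forall_fin_two] using ⟨h, h.symm⟩
    have k0 : ∀ q q' a, q ≠ q' → ¬ (δ q a = some q' ∧ δ q' a = none) :=
      fun q q' a hq h => h0 <| magEmbeds_autMul (ν := N0δ) (by decide) ![q, q'] ![a] (inj hq) (by
        simp [Fin.forall_fin_two, N0δ, h])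
    have k1 : ∀ q q' a b, q ≠ q' → ¬ (δ q a = some q' ∧ δ q' a = some q' ∧
        δ q b = none ∧ δ q' b = some q') :=
      fun q q' a b hq h => h1 <| magEmbeds_autMul (ν := N1δ) (by decide) ![q, q'] ![a, b] (inj hq) (by
        simp [Fin.forall_fin_two, N1δ, h])
    have k2 : ∀ q q' a b, q ≠ q' → ¬ (δ q a = some q' ∧ δ q' a = some q ∧
        δ q b = none ∧ δ q' b = some q') :=
      fun q q' a b hq h => h2 <| magEmbeds_autMul (ν := N2δ) (by decide) ![q, q'] ![a, b] (inj hq) (by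
        simp [Fin.forall_fin_two, N2δ, h])
    have k3 : ∀ q q' a b, q ≠ q' → ¬ (δ q a = some q' ∧ δ q' a = some q' ∧
        δ q b = some q ∧ δ q' b = none) :=
      fun q q' a b hq h => h3 <| magEmbeds_autMul (ν := N3δ) (by decide) ![q, q'] ![a, b] (inj hq) (by
        simp [Fin.forall_fin_two, N3δ, h])
    have k4 : ∀ q q' a b, q ≠ q' → ¬ (δ q a = some q' ∧ δ q' a = some q' ∧
        δ q b = some q' ∧ δ q' b = some q) :=
      fun q q' a b hq h => h4 <| magEmbeds_autMul (ν := N4δ) (by decide) ![q, q'] ![a, b] (inj hq) (by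
        simp [Fin.forall_fin_two, N4δ, h])
    have k5 : ∀ q q' a b c, q ≠ q' → ¬ (δ q a = some q' ∧ δ q' a = some q' ∧
        δ q b = some q ∧ δ q' b = some q ∧ δ q c = some q ∧ δ q' c = some q') :=
      fun q q' a b c hq h => h5 <| magEmbeds_autMul (ν := N5δ) (by decide) ![q, q'] ![a, b, c] (inj hq) (by
        simp [Fin.forall_fin_succ, N5δ, h])
    refine ⟨autMul_cubed hpr hall k0, ?_⟩
    rintro (_ | w | w) (_ | x | a) (_ | y | b) (_ | z | c) <;> try (simp [autMul]; done)
    have hw : some (Sum.inl w : Q ⊕ S) = (some w).map Sum.inl := rfl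
    simp only [hw, autMul_map_inl_inr]
    congr 1
    have ha := transition_cases hpr hall k0 a
    have hb := transition_cases hpr hall k0 b
    have hc := transition_cases hpr hall k0 c
    rcases hall w with rfl | rfl <;>
    rcases ha with ha | ha | ha | ha | ha | ha | ha <;>
    rcases hb with hb | hb | hb | hb | hb | hb | hb <;>
    first
    | (simp [ha, hb]; done)
    | (exfalso; grind)
    | (rcases hc with hc | hc | hc | hc | hc | hc | hc <;>
       first
       | (simp [ha, hb, hc]; done)
       | (exfalso; grind))
end

section
/- Let M be a total automatic algebra, i.e., an automatic algebra in which q·a ∈ Q for every q ∈ Q and a ∈ Σ. Define the binary operation ⋏ on M by u ⋏ v = u if (u, v) ∈ Q × Q or (u, v) ∈ Σ × Σ, and u ⋏ v = 0 otherwise. Then ⋏ : M × M → M is a multiplication-preserving map, i.e., for all x, y, u, v ∈ M, (x·u) ⋏ (y·v) = (x ⋏ y)·(u ⋏ v). -/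
/-- The quasi-meet operation `⋏` on an automatic algebra:
`u ⋏ v = u` if both `u, v` are states or both are letters, and `u ⋏ v = 0` otherwise. -/
def qmeet {Q S : Type} : Option (Q ⊕ S) → Option (Q ⊕ S) → Option (Q ⊕ S)
  | some (Sum.inl q), some (Sum.inl _) => some (Sum.inl q)
  | some (Sum.inr a), some (Sum.inr _) => some (Sum.inr a)
  | _, _ => none

/-- Let `M` be a total automatic algebra (here `δ : Q → S → Q` is everywhere defined).
Then the quasi-meet `⋏ : M × M → M` is multiplication-preserving:
`(x·u) ⋏ (y·v) = (x ⋏ y) · (u ⋏ v)` for all `x, y, u, v ∈ M`. -/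
theorem qmeet_is_homomorphism {Q S : Type} [Fintype Q] [Fintype S] (δ : Q → S → Q) :
    ∀ x y u v : Option (Q ⊕ S),
      qmeet (autMul (fun q a => some (δ q a)) x u) (autMul (fun q a => some (δ q a)) y v) =
        autMul (fun q a => some (δ q a)) (qmeet x y) (qmeet u v) := by
  rintro (_ | _ | _) (_ | _ | _) (_ | _ | _) (_ | _ | _) <;> rfl
end
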